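/- arXiv:1708.03283 — 3 statements merged into one kernel-verified Lean document; each statement's English description precedes it below -/
import Mathlib

section
/- Let n ≥ 3 be odd and let A be a persymmetric real symmetric tridiagonal n×n matrix with off-diagonal entries A_{j,j+1} = r_j > 0 and diagonal entries A_{j,j} = q_j. Let α_1 < α_2 < ... < α_n be the eigenvalues of A, and set S_1 = Σ_{r=1}^n (-1)^{r+n} α_r and S_2 = Σ_{r=1}^n (-1)^{r+n} α_r². Then q_{(n+1)/2} = S_1 and r_{(n-1)/2} = √(S_2 - S_1²)/2. -/
open Matrix Polynomial

/-- The Hamiltonian (adjacency matrix with potentials) of a weighted path on `n`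
vertices: tridiagonal, with diagonal entries `q 1, …, q n` (potentials) and
off-diagonal entries `r 1, …, r (n-1)` (edge weights); 1-based vertex labels. -/
noncomputable def pathHamiltonian (n : ℕ) (q r : ℕ → ℝ) : Matrix (Fin n) (Fin n) ℝ :=
  Matrix.of fun j k =>
    if (j : ℕ) = (k : ℕ) then q ((j : ℕ) + 1)
    else if (j : ℕ) + 1 = (k : ℕ) then r ((j : ℕ) + 1)
    else if (k : ℕ) + 1 = (j : ℕ) then r ((k : ℕ) + 1)
    else 0

/-- The exchange matrix, with ones on the antidiagonal. -/
noncomputable def exchangeMatrix (n : ℕ) : Matrix (Fin n) (Fin n) ℝ :=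
  Matrix.of fun i j => if j = i.rev then 1 else 0

lemma exchangeMatrix_mul_apply {n : ℕ} (B : Matrix (Fin n) (Fin n) ℝ) (i j : Fin n) :
    (exchangeMatrix n * B) i j = B i.rev j := by
  simp [exchangeMatrix, Matrix.mul_apply]

lemma mul_exchangeMatrix_apply {n : ℕ} (B : Matrix (Fin n) (Fin n) ℝ) (i j : Fin n) :
    (B * exchangeMatrix n) i j = B i j.rev := by
  have h : ∀ x : Fin n, j = x.rev ↔ x = j.rev := fun x =>
    ⟨fun h => by simp [h], fun h => by simp [h]⟩
  simp [exchangeMatrix, Matrix.mul_apply, h]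

lemma exchangeMatrix_mul_self (n : ℕ) : exchangeMatrix n * exchangeMatrix n = 1 := by
  ext i j
  rw [exchangeMatrix_mul_apply]
  simp [exchangeMatrix, Matrix.one_apply, eq_comm]

lemma pathHamiltonian_isSymm (n : ℕ) (q r : ℕ → ℝ) : (pathHamiltonian n q r).IsSymm := by
  ext i j
  simp only [pathHamiltonian, Matrix.transpose_apply, Matrix.of_apply]
  split_ifs <;> first | omega | rfl | simp_all

lemma exchangeMatrix_commute_pathHamiltonian {n : ℕ} {q r : ℕ → ℝ}
    (hpersym : ∀ j k : Fin n,
      pathHamiltonian n q r j k = pathHamiltonian n q r k.rev j.rev) :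
    exchangeMatrix n * pathHamiltonian n q r = pathHamiltonian n q r * exchangeMatrix n := by
  ext i j
  rw [exchangeMatrix_mul_apply, mul_exchangeMatrix_apply, hpersym, Fin.rev_rev,
    (pathHamiltonian_isSymm n q r).apply]

/-- The first row of the `k`-th power of a path Hamiltonian is supported on the first `k + 1`
entries, the last of which is positive. -/
lemma pathHamiltonian_pow_zero_apply {m : ℕ} {q r : ℕ → ℝ}
    (hr : ∀ j, 1 ≤ j → j ≤ m → 0 < r j) (k : ℕ) :
    ∀ j : Fin (m + 1), (k < j → (pathHamiltonian (m + 1) q r ^ k) 0 j = 0) ∧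
      ((j : ℕ) = k → 0 < (pathHamiltonian (m + 1) q r ^ k) 0 j) := by
  induction k with
  | zero =>
    intro j
    refine ⟨fun h => ?_, fun h => ?_⟩
    · have : (0 : Fin (m + 1)) ≠ j := by rintro rfl; simp at h
      simp [this]
    · obtain rfl : j = 0 := Fin.ext h
      simp
  | succ k ih =>
    intro j
    refine ⟨fun h => ?_, fun h => ?_⟩
    · rw [pow_succ, Matrix.mul_apply]
      refine Finset.sum_eq_zero fun l _ => ?_
      by_cases hl : k < l
      · rw [(ih l).1 hl, zero_mul]
      · have : pathHamiltonian (m + 1) q r l j = 0 := by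
          simp only [pathHamiltonian, Matrix.of_apply]
          split_ifs <;> first | omega | rfl
        rw [this, mul_zero]
    · have hj := j.2
      rw [pow_succ, Matrix.mul_apply, Finset.sum_eq_single ⟨k, by omega⟩]
      · refine mul_pos ((ih _).2 rfl) ?_
        have : pathHamiltonian (m + 1) q r ⟨k, by omega⟩ j = r (k + 1) := by
          simp only [pathHamiltonian, Matrix.of_apply]
          split_ifs <;> first | omega | rfl
        rw [this]
        exact hr _ (by omega) (by omega)
      · intro l _ hl
        have hl' : (l : ℕ) ≠ k := fun e => hl (Fin.ext e)
        by_cases hl : k < l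
        · rw [(ih l).1 hl, zero_mul]
        · have : pathHamiltonian (m + 1) q r l j = 0 := by
            simp only [pathHamiltonian, Matrix.of_apply]
            split_ifs <;> first | omega | rfl
          rw [this, mul_zero]
      · simp

lemma Matrix.IsSymm.exists_orthogonal_diagonalization {n : ℕ} {A : Matrix (Fin n) (Fin n) ℝ}
    (hA : A.IsSymm) : ∃ (U : Matrix (Fin n) (Fin n) ℝ) (l : Fin n → ℝ),
      U * Uᵀ = 1 ∧ Uᵀ * U = 1 ∧ A = U * diagonal l * Uᵀ ∧
        A.charpoly = ∏ i, (X - C (l i)) := by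
  have hH : A.IsHermitian := by
    rw [Matrix.IsHermitian, Matrix.conjTranspose_eq_transpose_of_trivial]
    exact hA
  have hU := hH.eigenvectorUnitary.2
  rw [Matrix.mem_unitaryGroup_iff, Matrix.star_eq_conjTranspose,
    Matrix.conjTranspose_eq_transpose_of_trivial] at hU
  refine ⟨hH.eigenvectorUnitary, hH.eigenvalues, hU, mul_eq_one_comm.1 hU, ?_, ?_⟩
  · have := hH.spectral_theorem
    rw [Unitary.conjStarAlgAut_apply, Matrix.star_eq_conjTranspose,
      Matrix.conjTranspose_eq_transpose_of_trivial] at this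
    exact this
  · simpa using hH.charpoly_eq

lemma pow_diagonalization {n : ℕ} {A U : Matrix (Fin n) (Fin n) ℝ} {l : Fin n → ℝ}
    (hU : U * Uᵀ = 1) (hU' : Uᵀ * U = 1) (hA : A = U * diagonal l * Uᵀ) (k : ℕ) :
    A ^ k = U * diagonal (fun i => l i ^ k) * Uᵀ := by
  induction k with
  | zero => simp [hU]
  | succ k ih =>
    rw [pow_succ, ih]
    calc U * diagonal (fun i => l i ^ k) * Uᵀ * A
        = U * diagonal (fun i => l i ^ k) * Uᵀ * (U * diagonal l * Uᵀ) := by rw [← hA]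
      _ = U * diagonal (fun i => l i ^ k) * (Uᵀ * U) * diagonal l * Uᵀ := by
            simp only [Matrix.mul_assoc]
      _ = _ := by
            rw [hU', Matrix.mul_one, Matrix.mul_assoc U, Matrix.diagonal_mul_diagonal]
            simp only [pow_succ]

/-- The product of the end coordinates of an eigenvector of a path Hamiltonian has the sign of
the derivative of the characteristic polynomial at the eigenvalue. -/
lemma eval_derivative_mul_eigenvector_ends_pos {m : ℕ} {q r : ℕ → ℝ}
    (hr : ∀ j, 1 ≤ j → j ≤ m → 0 < r j)
    {U : Matrix (Fin (m + 1)) (Fin (m + 1)) ℝ} {l : Fin (m + 1) → ℝ}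
    (hU : U * Uᵀ = 1) (hU' : Uᵀ * U = 1)
    (hA : pathHamiltonian (m + 1) q r = U * diagonal l * Uᵀ) (i : Fin (m + 1)) :
    0 < (derivative (∏ i, (X - C (l i)))).eval (l i) * (U 0 i * U (Fin.last m) i) := by
  have hd : (derivative (∏ i, (X - C (l i)))).eval (l i)
      = (Lagrange.nodal (Finset.univ.erase i) l).eval (l i) :=
    Lagrange.eval_nodal_derivative_eval_node_eq (Finset.mem_univ i)
  rw [hd]
  set f := Lagrange.nodal (Finset.univ.erase i) l with hf
  have hdeg : f.natDegree = m := by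
    rw [hf, Lagrange.natDegree_nodal]; simp
  have hmonic : f.coeff m = 1 := by
    have : f.Monic := Lagrange.nodal_monic
    rw [← hdeg]; exact this
  have hsum : ∑ s, f.eval (l s) * (U 0 s * U (Fin.last m) s)
      = f.eval (l i) * (U 0 i * U (Fin.last m) i) := by
    refine Finset.sum_eq_single i (fun s _ hs => ?_) (by simp)
    rw [hf, Lagrange.eval_nodal_at_node (by simp [hs]), zero_mul]
  have hpow : ∀ k, (pathHamiltonian (m + 1) q r ^ k) 0 (Fin.last m)
      = ∑ s, l s ^ k * (U 0 s * U (Fin.last m) s) := by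
    intro k
    rw [pow_diagonalization hU hU' hA, Matrix.mul_apply]
    refine Finset.sum_congr rfl fun s _ => ?_
    rw [Matrix.mul_diagonal, Matrix.transpose_apply]; ring
  rw [← hsum]
  have : ∑ s, f.eval (l s) * (U 0 s * U (Fin.last m) s)
      = ∑ k ∈ Finset.range (m + 1),
        f.coeff k * (pathHamiltonian (m + 1) q r ^ k) 0 (Fin.last m) := by
    simp_rw [hpow, Finset.mul_sum]
    rw [Finset.sum_comm]
    refine Finset.sum_congr rfl fun s _ => ?_
    rw [eval_eq_sum_range, hdeg, Finset.sum_mul]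
    exact Finset.sum_congr rfl fun k _ => by ring
  rw [this, Finset.sum_range_succ, Finset.sum_eq_zero, hmonic, zero_add, one_mul]
  · exact (pathHamiltonian_pow_zero_apply hr m _).2 (by simp)
  · intro k hk
    rw [(pathHamiltonian_pow_zero_apply hr k _).1 (by simpa using hk), mul_zero]

/-- Since each eigenvector of a persymmetric path Hamiltonian is symmetric or antisymmetric
according to the sign of the derivative of the characteristic polynomial at its eigenvalue, the
traces against the exchange matrix are the correspondingly signed power sums. -/
lemma trace_exchangeMatrix_mul_pow {m : ℕ} {q r : ℕ → ℝ}
    (hr : ∀ j, 1 ≤ j → j ≤ m → 0 < r j)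
    (hcomm : exchangeMatrix (m + 1) * pathHamiltonian (m + 1) q r
      = pathHamiltonian (m + 1) q r * exchangeMatrix (m + 1))
    {U : Matrix (Fin (m + 1)) (Fin (m + 1)) ℝ} {l : Fin (m + 1) → ℝ} (hl : l.Injective)
    (hU : U * Uᵀ = 1) (hU' : Uᵀ * U = 1)
    (hA : pathHamiltonian (m + 1) q r = U * diagonal l * Uᵀ) (k : ℕ) :
    (exchangeMatrix (m + 1) * pathHamiltonian (m + 1) q r ^ k).trace
      = ∑ i, (SignType.sign ((derivative (∏ i, (X - C (l i)))).eval (l i)) : ℝ) * l i ^ k := by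
  set J := exchangeMatrix (m + 1) with hJ
  set M := Uᵀ * J * U with hM
  have hUM : U * M = J * U := by
    rw [hM, ← Matrix.mul_assoc, ← Matrix.mul_assoc, hU, Matrix.one_mul]
  have hMM : M * M = 1 := by
    nth_rw 1 [hM]
    rw [Matrix.mul_assoc, hUM, Matrix.mul_assoc, ← Matrix.mul_assoc J J,
      exchangeMatrix_mul_self, Matrix.one_mul, hU']
  have hAU : pathHamiltonian (m + 1) q r * U = U * diagonal l := by
    rw [hA, Matrix.mul_assoc, hU', Matrix.mul_one]
  have hUA : Uᵀ * pathHamiltonian (m + 1) q r = diagonal l * Uᵀ := by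
    rw [hA, ← Matrix.mul_assoc, ← Matrix.mul_assoc, hU', Matrix.one_mul]
  have hMD : M * diagonal l = diagonal l * M := by
    calc M * diagonal l = Uᵀ * J * (U * diagonal l) := by rw [hM, Matrix.mul_assoc]
      _ = Uᵀ * (J * pathHamiltonian (m + 1) q r) * U := by
        rw [← hAU]; simp only [Matrix.mul_assoc]
      _ = (Uᵀ * pathHamiltonian (m + 1) q r) * J * U := by
        rw [hcomm]; simp only [Matrix.mul_assoc]
      _ = diagonal l * M := by rw [hUA, hM]; simp only [Matrix.mul_assoc]
  have hoff : ∀ i j, i ≠ j → M i j = 0 := by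
    intro i j hij
    have h := congrFun (congrFun hMD i) j
    rw [Matrix.mul_diagonal, Matrix.diagonal_mul, mul_comm, ← sub_eq_zero, ← sub_mul] at h
    refine (mul_eq_zero.1 h).resolve_left fun h0 => hij ?_
    exact (hl (sub_eq_zero.1 h0)).symm
  have hsign : ∀ i, M i i
      = (SignType.sign ((derivative (∏ i, (X - C (l i)))).eval (l i)) : ℝ) := by
    intro i
    have h1 : M i i * M i i = 1 := by
      have h := congrFun (congrFun hMM i) i
      rw [Matrix.mul_apply, Finset.sum_eq_single i (fun s _ hs => by
        rw [hoff i s hs.symm, zero_mul]) (by simp), Matrix.one_apply_eq] at h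
      exact h
    have h2 : U (Fin.last m) i = U 0 i * M i i := by
      have h := congrFun (congrFun hUM 0) i
      rw [Matrix.mul_apply, Finset.sum_eq_single i (fun s _ hs => by
        rw [hoff s i hs, mul_zero]) (by simp), exchangeMatrix_mul_apply, Fin.rev_zero] at h
      exact h.symm
    have h3 := eval_derivative_mul_eigenvector_ends_pos hr hU hU' hA i
    rw [h2] at h3
    rcases mul_self_eq_one_iff.1 h1 with h | h
    · rw [h] at h3 ⊢
      rw [sign_pos (by nlinarith [mul_self_nonneg (U 0 i)])]; simp
    · rw [h] at h3 ⊢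
      rw [sign_neg (by nlinarith [mul_self_nonneg (U 0 i)])]; simp
  rw [pow_diagonalization hU hU' hA, ← Matrix.mul_assoc, Matrix.trace_mul_comm,
    ← Matrix.mul_assoc, ← Matrix.mul_assoc, Matrix.trace]
  refine Finset.sum_congr rfl fun i _ => ?_
  rw [Matrix.diag_apply, Matrix.mul_diagonal, ← hM, hsign]

lemma sign_eval_derivative_prod_X_sub_C {n : ℕ} {α : ℕ → ℝ}
    (hα : StrictMonoOn α (Set.Icc 1 n)) {i : ℕ} (hi : i ∈ Finset.Icc 1 n) :
    (SignType.sign ((derivative (∏ i ∈ Finset.Icc 1 n, (X - C (α i)))).eval (α i)) : ℝ)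
      = (-1) ^ (i + n) := by
  have hd : (derivative (∏ i ∈ Finset.Icc 1 n, (X - C (α i)))).eval (α i)
      = (Lagrange.nodal ((Finset.Icc 1 n).erase i) α).eval (α i) :=
    Lagrange.eval_nodal_derivative_eval_node_eq hi
  have hi' := Finset.mem_Icc.1 hi
  have hsplit : (Finset.Icc 1 n).erase i = Finset.Ico 1 i ∪ Finset.Ioc i n := by
    ext j; simp only [Finset.mem_erase, Finset.mem_Icc, Finset.mem_union, Finset.mem_Ico,
      Finset.mem_Ioc]; omega
  have hdisj : Disjoint (Finset.Ico 1 i) (Finset.Ioc i n) := by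
    rw [Finset.disjoint_left]; intro j; simp only [Finset.mem_Ico, Finset.mem_Ioc]; omega
  have hneg : ∏ j ∈ Finset.Ioc i n, (α i - α j)
      = (-1) ^ (n - i) * ∏ j ∈ Finset.Ioc i n, (α j - α i) := by
    rw [← Nat.card_Ioc, ← Finset.prod_const, ← Finset.prod_mul_distrib]
    exact Finset.prod_congr rfl fun j _ => by ring
  have hpar : (-1 : ℝ) ^ (i + n) = (-1) ^ (n - i) := by
    rw [show i + n = (n - i) + 2 * i by omega, pow_add, pow_mul]; simp
  have hpos1 : 0 < ∏ j ∈ Finset.Ico 1 i, (α i - α j) := Finset.prod_pos fun j hj => by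
    rw [Finset.mem_Ico] at hj
    exact sub_pos.2 (hα ⟨hj.1, by omega⟩ hi' hj.2)
  have hpos2 : 0 < ∏ j ∈ Finset.Ioc i n, (α j - α i) := Finset.prod_pos fun j hj => by
    rw [Finset.mem_Ioc] at hj
    exact sub_pos.2 (hα hi' ⟨by omega, hj.2⟩ hj.1)
  rw [hd, Lagrange.eval_nodal, hsplit, Finset.prod_union hdisj, hneg, hpar, sign_mul, sign_mul,
    sign_pos hpos1, sign_pos hpos2]
  rcases neg_one_pow_eq_or ℝ (n - i) with h | h <;> rw [h] <;> simp

/-- The moments of the exchange matrix against a persymmetric path Hamiltonian are the alternating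
power sums of the eigenvalues. -/
lemma trace_exchangeMatrix_mul_pow_eq_alternating_sum {n : ℕ} (hn : 1 ≤ n) {q r : ℕ → ℝ}
    (hr : ∀ j, 1 ≤ j → j ≤ n - 1 → 0 < r j)
    (hpersym : ∀ j k : Fin n,
      pathHamiltonian n q r j k = pathHamiltonian n q r k.rev j.rev)
    {α : ℕ → ℝ} (hα : StrictMonoOn α (Set.Icc 1 n))
    (hchar : (pathHamiltonian n q r).charpoly = ∏ i ∈ Finset.Icc 1 n, (X - C (α i))) (k : ℕ) :
    (exchangeMatrix n * pathHamiltonian n q r ^ k).trace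
      = ∑ i ∈ Finset.Icc 1 n, (-1 : ℝ) ^ (i + n) * α i ^ k := by
  obtain ⟨m, rfl⟩ : ∃ m, n = m + 1 := ⟨n - 1, by omega⟩
  rw [Nat.add_sub_cancel] at hr
  obtain ⟨U, l, hU, hU', hA, hl⟩ :=
    (pathHamiltonian_isSymm (m + 1) q r).exists_orthogonal_diagonalization
  have hprod := hchar.symm.trans hl
  have hroots : (Finset.Icc 1 (m + 1)).val.map α =
      (Finset.univ : Finset (Fin (m + 1))).val.map l := by
    have h := congrArg Polynomial.roots hprod
    have e1 : ∏ i ∈ Finset.Icc 1 (m + 1), (X - C (α i))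
        = (((Finset.Icc 1 (m + 1)).val.map α).map fun a => X - C a).prod := by
      rw [Multiset.map_map]; rfl
    have e2 : ∏ i, (X - C (l i))
        = (((Finset.univ : Finset (Fin (m + 1))).val.map l).map fun a => X - C a).prod := by
      rw [Multiset.map_map]; rfl
    rwa [e1, e2, roots_multiset_prod_X_sub_C, roots_multiset_prod_X_sub_C] at h
  have hinj : l.Injective := by
    have h : ((Finset.univ : Finset (Fin (m + 1))).val.map l).Nodup := by
      rw [← hroots, Multiset.nodup_map_iff_inj_on (Finset.nodup _)]
      intro x hx y hy hxy
      exact hα.injOn (by simpa using hx) (by simpa using hy) hxy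
    rw [Multiset.nodup_map_iff_inj_on (Finset.nodup _)] at h
    exact fun x y hxy => h x (by simp) y (by simp) hxy
  rw [trace_exchangeMatrix_mul_pow hr (exchangeMatrix_commute_pathHamiltonian hpersym) hinj
    hU hU' hA, ← hprod]
  set g : ℝ → ℝ := fun x => (SignType.sign ((derivative
    (∏ i ∈ Finset.Icc 1 (m + 1), (X - C (α i)))).eval x) : ℝ) * x ^ k with hg
  have h := congrArg (fun s => (s.map g).sum) hroots
  simp only [Multiset.map_map] at h
  refine h.symm.trans (Finset.sum_congr rfl fun i hi => ?_)
  simp only [Function.comp, hg]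
  rw [sign_eval_derivative_prod_X_sub_C hα hi]

lemma trace_exchangeMatrix_mul_pathHamiltonian (m : ℕ) (q r : ℕ → ℝ) :
    (exchangeMatrix (2 * m + 1) * pathHamiltonian (2 * m + 1) q r).trace = q (m + 1) := by
  rw [Matrix.trace, Finset.sum_eq_single ⟨m, by omega⟩]
  · rw [Matrix.diag_apply, exchangeMatrix_mul_apply]
    simp only [pathHamiltonian, Matrix.of_apply, Fin.val_rev]
    rw [if_pos (by omega), show 2 * m + 1 - (m + 1) = m by omega]
  · intro i _ hi
    have hi' : (i : ℕ) ≠ m := fun e => hi (Fin.ext e)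
    rw [Matrix.diag_apply, exchangeMatrix_mul_apply]
    simp only [pathHamiltonian, Matrix.of_apply, Fin.val_rev]
    split_ifs <;> first | omega | rfl
  · simp

lemma trace_exchangeMatrix_mul_pathHamiltonian_sq {m : ℕ} (hm : 1 ≤ m) (q r : ℕ → ℝ) :
    (exchangeMatrix (2 * m + 1) * pathHamiltonian (2 * m + 1) q r ^ 2).trace
      = q (m + 1) ^ 2 + (r m + r (m + 1)) ^ 2 := by
  have hsum : (exchangeMatrix (2 * m + 1) * pathHamiltonian (2 * m + 1) q r ^ 2).trace
      = ∑ p : Fin (2 * m + 1) × Fin (2 * m + 1), pathHamiltonian (2 * m + 1) q r p.1.rev p.2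
        * pathHamiltonian (2 * m + 1) q r p.2 p.1 := by
    rw [Fintype.sum_prod_type, Matrix.trace]
    refine Finset.sum_congr rfl fun i _ => ?_
    rw [Matrix.diag_apply, exchangeMatrix_mul_apply, pow_two, Matrix.mul_apply]
  let a : Fin (2 * m + 1) := ⟨m - 1, by omega⟩
  let b : Fin (2 * m + 1) := ⟨m, by omega⟩
  let c : Fin (2 * m + 1) := ⟨m + 1, by omega⟩
  have hab : a ≠ b := by simp only [a, b, ne_eq, Fin.mk.injEq]; omega
  have hac : a ≠ c := by simp only [a, c, ne_eq, Fin.mk.injEq]; omega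
  have hbc : b ≠ c := by simp only [b, c, ne_eq, Fin.mk.injEq]; omega
  have hra : a.rev = c := by ext; simp only [a, c, Fin.val_rev]; omega
  have hrb : b.rev = b := by ext; simp only [b, Fin.val_rev]; omega
  have hrc : c.rev = a := by ext; simp only [a, c, Fin.val_rev]; omega
  have hbb : pathHamiltonian (2 * m + 1) q r b b = q (m + 1) := by
    simp [pathHamiltonian, b]
  have hAab : pathHamiltonian (2 * m + 1) q r a b = r m := by
    simp only [pathHamiltonian, Matrix.of_apply, a, b]
    rw [if_neg (by omega), if_pos (by omega), Nat.sub_add_cancel hm]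
  have hAbc : pathHamiltonian (2 * m + 1) q r b c = r (m + 1) := by
    simp [pathHamiltonian, b, c]
  have hAba : pathHamiltonian (2 * m + 1) q r b a = r m :=
    ((pathHamiltonian_isSymm _ q r).apply a b).trans hAab
  have hAcb : pathHamiltonian (2 * m + 1) q r c b = r (m + 1) :=
    ((pathHamiltonian_isSymm _ q r).apply b c).trans hAbc
  rw [hsum, ← Finset.sum_subset
    (Finset.subset_univ ({(b, b), (b, a), (b, c), (a, b), (c, b)} : Finset _))]
  · rw [Finset.sum_insert (by simp [hab.symm, hbc]),
      Finset.sum_insert (by simp [hab, hab.symm, hac]),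
      Finset.sum_insert (by simp [hab.symm, hbc]),
      Finset.sum_insert (by simp [hac]), Finset.sum_singleton]
    simp only [hra, hrb, hrc, hbb, hAab, hAbc, hAba, hAcb]
    ring
  · rintro ⟨i, j⟩ _ hp
    simp only [Finset.mem_insert, Finset.mem_singleton, Prod.mk.injEq, not_or, a, b, c,
      Fin.ext_iff] at hp
    simp only [pathHamiltonian, Matrix.of_apply, Fin.val_rev]
    split_ifs <;> first | omega | simp

/-- For `n` odd, a persymmetric weighted path Hamiltonian with eigenvalues
`α 1 < ⋯ < α n` satisfies `q ((n+1)/2) = S₁` and `r ((n-1)/2) = √(S₂ - S₁²)/2`, where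
`S₁ = ∑ (-1)^(r+n) α r` and `S₂ = ∑ (-1)^(r+n) (α r)^2`. -/
theorem middle_entries_odd (n : ℕ) (hn : 3 ≤ n) (hodd : Odd n) (q r : ℕ → ℝ)
    (hr : ∀ j, 1 ≤ j → j ≤ n - 1 → 0 < r j)
    (hpersym : ∀ j k : Fin n,
      pathHamiltonian n q r j k = pathHamiltonian n q r k.rev j.rev)
    (α : ℕ → ℝ) (hα : StrictMonoOn α (Set.Icc 1 n))
    (hchar : (pathHamiltonian n q r).charpoly = ∏ i ∈ Finset.Icc 1 n, (X - C (α i)))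
    (S₁ S₂ : ℝ)
    (hS₁ : S₁ = ∑ i ∈ Finset.Icc 1 n, (-1 : ℝ) ^ (i + n) * α i)
    (hS₂ : S₂ = ∑ i ∈ Finset.Icc 1 n, (-1 : ℝ) ^ (i + n) * (α i) ^ 2) :
    q ((n + 1) / 2) = S₁ ∧ r ((n - 1) / 2) = Real.sqrt (S₂ - S₁ ^ 2) / 2 := by
  obtain ⟨m, rfl⟩ := hodd
  have hm : 1 ≤ m := by omega
  have h1 := trace_exchangeMatrix_mul_pow_eq_alternating_sum (by omega) hr hpersym hα hchar 1
  have h2 := trace_exchangeMatrix_mul_pow_eq_alternating_sum (by omega) hr hpersym hα hchar 2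
  rw [pow_one, trace_exchangeMatrix_mul_pathHamiltonian] at h1
  simp only [pow_one] at h1
  rw [← hS₁] at h1
  rw [trace_exchangeMatrix_mul_pathHamiltonian_sq hm, ← hS₂] at h2
  have hrr : r m = r (m + 1) := by
    have h := hpersym ⟨m - 1, by omega⟩ ⟨m, by omega⟩
    simp only [pathHamiltonian, Matrix.of_apply, Fin.val_rev] at h
    rw [if_neg (by omega), if_pos (by omega), if_neg (by omega), if_pos (by omega),
      Nat.sub_add_cancel hm, show 2 * m + 1 - (m + 1) + 1 = m + 1 by omega] at h
    exact h
  have hpos : 0 < r m := hr m hm (by omega)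
  rw [show (2 * m + 1 + 1) / 2 = m + 1 by omega, show (2 * m + 1 - 1) / 2 = m by omega]
  refine ⟨h1, ?_⟩
  have hsq : S₂ - S₁ ^ 2 = (2 * r m) ^ 2 := by
    rw [← h1, ← h2, ← hrr]; ring
  rw [hsq, Real.sqrt_sq (by positivity)]
  ring
end

section
/- Let n ≥ 4 be even and let L be the Laplacian of a weighted path on n vertices with edge weights r_1, ..., r_{n-1} > 0, and assume L is persymmetric (equivalently, r_j = r_{n-j} for all j). Let α_1 < ... < α_n denote the eigenvalues of L, and set S_1 = Σ_{r=1}^n (-1)^{r+n} α_r and S_2 = Σ_{r=1}^n (-1)^{r+n} α_r². Then r_{n/2} = S_1/2 and r_{n/2 - 1} = (S_2 - S_1²)/(2S_1). -/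
open Matrix Polynomial

/-- The Laplacian of the weighted path on `n` vertices (1-based vertices `1,…,n`,
0-based `Fin n` indices) with edge weight `r j` between vertices `j` and `j+1`. -/
noncomputable def pathLaplacian (n : ℕ) (r : ℕ → ℝ) : Matrix (Fin n) (Fin n) ℝ :=
  Matrix.of fun j k =>
    if (j : ℕ) = (k : ℕ) then
      (if (j : ℕ) = 0 then 0 else r (j : ℕ)) + (if (j : ℕ) = n - 1 then 0 else r ((j : ℕ) + 1))
    else if (j : ℕ) + 1 = (k : ℕ) then -r ((j : ℕ) + 1)
    else if (k : ℕ) + 1 = (j : ℕ) then -r ((k : ℕ) + 1)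
    else 0

theorem det_fromBlocks_swap {R m : Type*} [CommRing R] [Fintype m] [DecidableEq m]
    (A B : Matrix m m R) :
    (fromBlocks A B B A).det = (A + B).det * (A - B).det := by
  have h : fromBlocks 1 0 (-1) 1 * fromBlocks A B B A * fromBlocks 1 0 1 1
      = fromBlocks (A + B) B 0 (A - B) := by
    simp only [fromBlocks_multiply]
    congr 1 <;> simp [add_comm, sub_eq_add_neg]
  have h' := congrArg det h
  simpa [det_mul, det_fromBlocks_zero₁₂, det_fromBlocks_zero₂₁] using h'

theorem charpoly_fromBlocks_swap {R m : Type*} [CommRing R] [Fintype m] [DecidableEq m]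
    (A B : Matrix m m R) :
    (fromBlocks A B B A).charpoly = (A + B).charpoly * (A - B).charpoly := by
  have h₁ : charmatrix A + -B.map C = charmatrix (A + B) := by
    ext1 i j
    simp only [charmatrix_apply, Matrix.add_apply, Matrix.neg_apply, Matrix.map_apply, C_add]
    ring
  have h₂ : charmatrix A - -B.map C = charmatrix (A - B) := by
    ext1 i j
    simp only [charmatrix_apply, Matrix.sub_apply, Matrix.neg_apply, Matrix.map_apply, C_sub]
    ring
  rw [charpoly, charmatrix_fromBlocks, det_fromBlocks_swap, h₁, h₂, charpoly, charpoly]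

theorem det_succ_succ_of_tridiagonal {R : Type*} [CommRing R] {k : ℕ}
    (M : Matrix (Fin (k + 2)) (Fin (k + 2)) R)
    (hrow : ∀ j : Fin k, M 0 j.succ.succ = 0) (hcol : ∀ j : Fin k, M j.succ.succ 0 = 0) :
    M.det = M 0 0 * (M.submatrix Fin.succ Fin.succ).det
      - M 0 1 * M 1 0 * (M.submatrix (Fin.succ ∘ Fin.succ) (Fin.succ ∘ Fin.succ)).det := by
  have hminor : (M.submatrix Fin.succ (Fin.succAbove 1)).det
      = M 1 0 * (M.submatrix (Fin.succ ∘ Fin.succ) (Fin.succ ∘ Fin.succ)).det := by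
    rw [det_succ_column_zero, Fin.sum_univ_succ]
    have hsub : (Fin.succAbove (1 : Fin (k + 2))) ∘ Fin.succ = Fin.succ ∘ Fin.succ := by
      funext j
      exact Fin.succ_succAbove_succ 0 j
    simp [hcol, hsub, Function.comp_def]
  rw [det_succ_row_zero, Fin.sum_univ_succ, Fin.sum_univ_succ]
  simp [hrow, hminor]
  ring

theorem charpoly_succ_succ_of_tridiagonal {R : Type*} [CommRing R] {k : ℕ}
    (M : Matrix (Fin (k + 2)) (Fin (k + 2)) R)
    (hrow : ∀ j : Fin k, M 0 j.succ.succ = 0) (hcol : ∀ j : Fin k, M j.succ.succ 0 = 0) :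
    M.charpoly = (X - C (M 0 0)) * (M.submatrix Fin.succ Fin.succ).charpoly
      - C (M 0 1 * M 1 0) *
        (M.submatrix (Fin.succ ∘ Fin.succ) (Fin.succ ∘ Fin.succ)).charpoly := by
  have hs : ∀ {l : ℕ} (f : Fin l → Fin (k + 2)), Function.Injective f →
      (charmatrix M).submatrix f f = charmatrix (M.submatrix f f) := by
    intro l f hf
    ext1 i j
    simp [charmatrix_apply, Matrix.diagonal_apply, hf.eq_iff]
  have h01 : (0 : Fin (k + 2)) ≠ 1 := by simp
  rw [charpoly, det_succ_succ_of_tridiagonal, hs _ (Fin.succ_injective _),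
    hs _ ((Fin.succ_injective _).comp (Fin.succ_injective _)), charmatrix_apply_eq,
    charmatrix_apply_ne _ _ _ h01, charmatrix_apply_ne _ _ _ h01.symm, charpoly, charpoly, C_mul,
    neg_mul_neg]
  · intro j
    rw [charmatrix_apply_ne _ _ _ (Fin.succ_ne_zero _).symm, hrow, C_0, neg_zero]
  · intro j
    rw [charmatrix_apply_ne _ _ _ (Fin.succ_ne_zero _), hcol, C_0, neg_zero]

/-- The symmetric tridiagonal matrix of size `k` with diagonal `d (k - 1), …, d 0` and
off-diagonal `e (k - 2), …, e 0`. -/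
def revJacobi {R : Type*} [Zero R] (d e : ℕ → R) (k : ℕ) : Matrix (Fin k) (Fin k) R :=
  Matrix.of fun i j =>
    if (i : ℕ) = j then d (k - 1 - i)
    else if (i : ℕ) + 1 = j then e (k - 1 - j)
    else if (j : ℕ) + 1 = i then e (k - 1 - i)
    else 0

theorem revJacobi_submatrix_succ {R : Type*} [Zero R] (d e : ℕ → R) (k : ℕ) :
    (revJacobi d e (k + 1)).submatrix Fin.succ Fin.succ = revJacobi d e k := by
  ext i j
  have hi : k - (i + 1) = k - 1 - i := by omega
  have hj : k - (j + 1) = k - 1 - j := by omega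
  simp only [revJacobi, submatrix_apply, of_apply, Fin.val_succ, add_left_inj,
    Nat.add_sub_cancel, hi, hj]

/-- Changing the top-left entry of a `revJacobi` matrix by `t` subtracts `t` times the next
smaller characteristic polynomial. -/
theorem charpoly_revJacobi_add {R : Type*} [CommRing R] (d e : ℕ → R) (k : ℕ) (t : R)
    (M : Matrix (Fin (k + 2)) (Fin (k + 2)) R)
    (hM : ∀ i j, M i j = revJacobi d e (k + 2) i j + if i = 0 ∧ j = 0 then t else 0) :
    M.charpoly = (X - C (d (k + 1) + t)) * (revJacobi d e (k + 1)).charpoly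
      - C (e k * e k) * (revJacobi d e k).charpoly := by
  have h1 : M.submatrix Fin.succ Fin.succ = revJacobi d e (k + 1) := by
    rw [← revJacobi_submatrix_succ]
    ext i j
    simp [hM]
  have h2 : M.submatrix (Fin.succ ∘ Fin.succ) (Fin.succ ∘ Fin.succ) = revJacobi d e k := by
    rw [← revJacobi_submatrix_succ, ← h1]
    rfl
  rw [charpoly_succ_succ_of_tridiagonal, h1, h2]
  · simp [hM, revJacobi]
  · intro j
    simp [hM, revJacobi]
  · intro j
    simp [hM, revJacobi]

theorem charpoly_revJacobi_succ_succ {R : Type*} [CommRing R] (d e : ℕ → R) (k : ℕ) :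
    (revJacobi d e (k + 2)).charpoly = (X - C (d (k + 1))) * (revJacobi d e (k + 1)).charpoly
      - C (e k * e k) * (revJacobi d e k).charpoly := by
  simpa using charpoly_revJacobi_add d e k 0 (revJacobi d e (k + 2)) (by simp)

theorem wronskian_charpoly_revJacobi_pos (d e : ℕ → ℝ) (k : ℕ) (x : ℝ) :
    0 < (derivative (revJacobi d e (k + 1)).charpoly).eval x * (revJacobi d e k).charpoly.eval x
      - (revJacobi d e (k + 1)).charpoly.eval x
        * (derivative (revJacobi d e k).charpoly).eval x
      ∨ ∃ j < k, e j = 0 := by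
  induction k with
  | zero =>
    left
    have h : (revJacobi d e 1).charpoly = X - C (d 0) := by
      simp [charpoly, revJacobi]
    simp [h]
  | succ k ih =>
    rcases ih with ih | ⟨j, hj, hj0⟩
    · by_cases he : e k = 0
      · exact Or.inr ⟨k, by omega, he⟩
      left
      rw [charpoly_revJacobi_succ_succ]
      simp only [derivative_sub, derivative_mul, derivative_X, derivative_C, eval_sub, eval_mul,
        eval_add, eval_X, eval_C, eval_one, eval_zero]
      have := mul_pos (mul_self_pos.2 he) ih
      nlinarith [mul_self_nonneg ((revJacobi d e (k + 1)).charpoly.eval x)]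
    · exact Or.inr ⟨j, by omega, hj0⟩

theorem two_mul_prod_X_sub_C_coeff {R ι : Type*} [CommRing R] [DecidableEq ι] (s : Finset ι)
    (f : ι → R) (k : ℕ) (hs : s.card = k + 2) :
    2 * (∏ i ∈ s, (X - C (f i))).coeff k = (∑ i ∈ s, f i) ^ 2 - ∑ i ∈ s, f i ^ 2 := by
  induction s using Finset.induction_on generalizing k with
  | empty => simp at hs
  | insert a s ha ih =>
    rw [Finset.card_insert_of_notMem ha] at hs
    have hs' : s.card = k + 1 := by omega
    have hk := prod_X_sub_C_coeff_card_pred s f (by omega)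
    rw [hs', Nat.add_sub_cancel] at hk
    rw [Finset.prod_insert ha, Finset.sum_insert ha, Finset.sum_insert ha]
    cases k with
    | zero =>
      obtain ⟨b, rfl⟩ := Finset.card_eq_one.1 hs'
      simp
      ring
    | succ k =>
      have := ih k hs'
      rw [coeff_X_sub_C_mul, hk]
      linear_combination this

/-- The sign of the derivative of a real-rooted polynomial with simple roots alternates. -/
theorem neg_one_pow_mul_eval_derivative_prod_pos (n : ℕ) (α : ℕ → ℝ)
    (hα : StrictMonoOn α (Set.Icc 1 n)) (i : ℕ) (hi : i ∈ Finset.Icc 1 n) :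
    0 < (-1) ^ (i + n) * (derivative (∏ j ∈ Finset.Icc 1 n, (X - C (α j)))).eval (α i) := by
  have hi' := Finset.mem_Icc.1 hi
  have hsplit : (Finset.Icc 1 n).erase i = Finset.Ico 1 i ∪ Finset.Ioc i n := by
    ext j
    simp only [Finset.mem_erase, Finset.mem_Icc, Finset.mem_union, Finset.mem_Ico, Finset.mem_Ioc]
    omega
  have hdisj : Disjoint (Finset.Ico 1 i) (Finset.Ioc i n) := by
    rw [Finset.disjoint_left]
    intro j
    simp only [Finset.mem_Ico, Finset.mem_Ioc]
    omega
  have h1 : 0 < ∏ j ∈ Finset.Ico 1 i, (α i - α j) := by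
    refine Finset.prod_pos fun j hj => sub_pos.2 (hα ?_ hi' ?_)
    · have := Finset.mem_Ico.1 hj
      exact ⟨this.1, by omega⟩
    · exact (Finset.mem_Ico.1 hj).2
  have h2 : 0 < ∏ j ∈ Finset.Ioc i n, (α j - α i) := by
    refine Finset.prod_pos fun j hj => sub_pos.2 (hα hi' ?_ ?_)
    · have := Finset.mem_Ioc.1 hj
      exact ⟨by omega, this.2⟩
    · exact (Finset.mem_Ioc.1 hj).1
  have h3 : ∏ j ∈ Finset.Ioc i n, (α i - α j)
      = (-1) ^ (n - i) * ∏ j ∈ Finset.Ioc i n, (α j - α i) := by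
    rw [← Nat.card_Ioc, ← Finset.prod_const, ← Finset.prod_mul_distrib]
    exact Finset.prod_congr rfl fun j _ => by ring
  have h4 : (-1 : ℝ) ^ (i + n) * (-1) ^ (n - i) = 1 := by
    rw [← pow_add]
    exact Even.neg_one_pow ⟨n, by omega⟩
  rw [← Finset.mul_prod_erase _ _ hi, derivative_mul]
  simp only [derivative_X_sub_C, eval_add, eval_mul, eval_sub, eval_X, eval_C, sub_self,
    zero_mul, add_zero, one_mul, eval_prod]
  rw [hsplit, Finset.prod_union hdisj, h3]
  calc 0 < (∏ j ∈ Finset.Ico 1 i, (α i - α j)) * ∏ j ∈ Finset.Ioc i n, (α j - α i) :=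
        mul_pos h1 h2
    _ = _ := by linear_combination (-(∏ j ∈ Finset.Ico 1 i, (α i - α j)) *
        ∏ j ∈ Finset.Ioc i n, (α j - α i)) * h4

/-- Two monic polynomials of degree `m` whose Wronskian is positive and whose product has the
simple real roots `α 1 < ⋯ < α (2m)` split those roots alternately between them. -/
theorem eq_prod_of_wronskian_pos (n m : ℕ) (hnm : n = m + m) (α : ℕ → ℝ)
    (hα : StrictMonoOn α (Set.Icc 1 n)) (p q : ℝ[X]) (hp : p.Monic) (hq : q.Monic)
    (hpd : p.natDegree = m) (hqd : q.natDegree = m)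
    (hpq : p * q = ∏ i ∈ Finset.Icc 1 n, (X - C (α i)))
    (hW : ∀ x, 0 < p.eval x * (derivative q).eval x - (derivative p).eval x * q.eval x) :
    ((Finset.Icc 1 n).filter (fun i => Even (i + n))).card = m ∧
    ((Finset.Icc 1 n).filter (fun i => ¬ Even (i + n))).card = m ∧
    q = ∏ i ∈ (Finset.Icc 1 n).filter (fun i => Even (i + n)), (X - C (α i)) ∧
    p = ∏ i ∈ (Finset.Icc 1 n).filter (fun i => ¬ Even (i + n)), (X - C (α i)) := by
  have hroot : ∀ i ∈ Finset.Icc 1 n, p.eval (α i) * q.eval (α i) = 0 := by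
    intro i hi
    rw [← eval_mul, hpq, eval_prod]
    exact Finset.prod_eq_zero hi (by simp)
  have hsign : ∀ i ∈ Finset.Icc 1 n, 0 < (-1) ^ (i + n) *
      ((derivative p).eval (α i) * q.eval (α i) + p.eval (α i) * (derivative q).eval (α i)) := by
    intro i hi
    have := neg_one_pow_mul_eval_derivative_prod_pos n α hα i hi
    rwa [← hpq, derivative_mul, eval_add, eval_mul, eval_mul] at this
  have hqroot : ∀ i ∈ (Finset.Icc 1 n).filter (fun i => Even (i + n)), q.IsRoot (α i) := by
    intro i hi
    obtain ⟨hi, he⟩ := Finset.mem_filter.1 hi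
    have h := hsign i hi
    rw [he.neg_one_pow] at h
    rcases mul_eq_zero.1 (hroot i hi) with h0 | h0
    · have := hW (α i)
      rw [h0] at this h
      linarith
    · exact h0
  have hproot : ∀ i ∈ (Finset.Icc 1 n).filter (fun i => ¬ Even (i + n)), p.IsRoot (α i) := by
    intro i hi
    obtain ⟨hi, he⟩ := Finset.mem_filter.1 hi
    have h := hsign i hi
    rw [(Nat.not_even_iff_odd.1 he).neg_one_pow] at h
    rcases mul_eq_zero.1 (hroot i hi) with h0 | h0
    · exact h0
    · have := hW (α i)
      rw [h0] at this h
      linarith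
  have hdvd : ∀ (f : ℝ[X]) (s : Finset ℕ), s ⊆ Finset.Icc 1 n → (∀ i ∈ s, f.IsRoot (α i)) →
      ∏ i ∈ s, (X - C (α i)) ∣ f := by
    intro f s hs hf
    refine Finset.prod_dvd_of_coprime (fun i hi j hj hij => ?_) fun i hi =>
      dvd_iff_isRoot.2 (hf i hi)
    refine isCoprime_X_sub_C_of_isUnit_sub (sub_ne_zero.2 fun h => hij ?_).isUnit
    exact hα.injOn (Finset.mem_Icc.1 (hs hi)) (Finset.mem_Icc.1 (hs hj)) h
  have hqdvd := hdvd q _ (Finset.filter_subset _ _) hqroot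
  have hpdvd := hdvd p _ (Finset.filter_subset _ _) hproot
  have hqle := natDegree_le_of_dvd hqdvd hq.ne_zero
  have hple := natDegree_le_of_dvd hpdvd hp.ne_zero
  have hcard := Finset.card_filter_add_card_filter_not (s := Finset.Icc 1 n)
    (fun i => Even (i + n))
  rw [natDegree_finsetProd_X_sub_C_eq_card] at hqle hple
  rw [Nat.card_Icc] at hcard
  refine ⟨by omega, by omega, ?_, ?_⟩
  · refine eq_of_monic_of_dvd_of_natDegree_le (monic_prod_X_sub_C _ _) hq hqdvd ?_
    rw [natDegree_finsetProd_X_sub_C_eq_card]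
    omega
  · refine eq_of_monic_of_dvd_of_natDegree_le (monic_prod_X_sub_C _ _) hp hpdvd ?_
    rw [natDegree_finsetProd_X_sub_C_eq_card]
    omega

theorem sum_neg_one_pow_mul_eq (s : Finset ℕ) (n : ℕ) (f : ℕ → ℝ) :
    ∑ i ∈ s, (-1 : ℝ) ^ (i + n) * f i
      = ∑ i ∈ s with Even (i + n), f i - ∑ i ∈ s with ¬ Even (i + n), f i := by
  rw [← Finset.sum_filter_add_sum_filter_not s (fun i => Even (i + n)), sub_eq_add_neg,
    ← Finset.sum_neg_distrib]
  congr 1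
  · refine Finset.sum_congr rfl fun i hi => ?_
    rw [(Finset.mem_filter.1 hi).2.neg_one_pow, one_mul]
  · refine Finset.sum_congr rfl fun i hi => ?_
    rw [(Nat.not_even_iff_odd.1 (Finset.mem_filter.1 hi).2).neg_one_pow, neg_one_mul]

/-- The diagonal of the Laplacian of a weighted path, away from its last vertex. -/
def pathDiag (r : ℕ → ℝ) (j : ℕ) : ℝ := (if j = 0 then 0 else r j) + r (j + 1)

/-- Listing the first half of the vertices backwards, and then the second half forwards, turns a
mirror-symmetric path Laplacian into a symmetric `2 × 2` block matrix. -/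
theorem charpoly_pathLaplacian_eq (m : ℕ) (hm : 1 ≤ m) (r : ℕ → ℝ)
    (hsymm : ∀ j, 1 ≤ j → j ≤ m + m - 1 → r (m + m - j) = r j) :
    (pathLaplacian (m + m) r).charpoly =
      (revJacobi (pathDiag r) (fun j => -r (j + 1)) m +
        Matrix.of fun i j : Fin m => if (i : ℕ) = 0 ∧ (j : ℕ) = 0 then -r m else 0).charpoly *
      (revJacobi (pathDiag r) (fun j => -r (j + 1)) m -
        Matrix.of fun i j : Fin m => if (i : ℕ) = 0 ∧ (j : ℕ) = 0 then -r m else 0).charpoly := by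
  let σ : Fin m ⊕ Fin m ≃ Fin (m + m) :=
    (Equiv.sumCongr Fin.revPerm (Equiv.refl _)).trans finSumFinEquiv
  rw [← charpoly_fromBlocks_swap, ← charpoly_reindex σ.symm (pathLaplacian (m + m) r)]
  congr 1
  ext i j
  rcases i with i | i <;> rcases j with j | j <;>
    obtain ⟨i, hi⟩ := i <;> obtain ⟨j, hj⟩ := j
  · simp only [σ, pathLaplacian, revJacobi, pathDiag, reindex_apply, submatrix_apply, of_apply,
      fromBlocks_apply₁₁, Equiv.symm_symm, Equiv.trans_apply, Equiv.sumCongr_apply, Sum.map_inl,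
      finSumFinEquiv_apply_left, Fin.revPerm_apply, Fin.val_castAdd, Fin.val_rev]
    have hi1 : m - (i + 1) = m - 1 - i := by omega
    have hj1 : m - (j + 1) = m - 1 - j := by omega
    have hi2 : m - 1 - i ≠ m + m - 1 := by omega
    simp only [hi1, hj1, hi2, if_false]
    split_ifs <;> first | rfl | omega
  · simp only [σ, pathLaplacian, reindex_apply, submatrix_apply, of_apply,
      fromBlocks_apply₁₂, Equiv.symm_symm, Equiv.trans_apply, Equiv.sumCongr_apply, Sum.map_inl,
      Sum.map_inr, Equiv.refl_apply, finSumFinEquiv_apply_right, Fin.val_natAdd,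
      finSumFinEquiv_apply_left, Fin.revPerm_apply, Fin.val_castAdd, Fin.val_rev]
    have h1 : m - (i + 1) ≠ m + j := by omega
    have h2 : m + j + 1 ≠ m - (i + 1) := by omega
    have h3 : m - (i + 1) + 1 = m + j ↔ i = 0 ∧ j = 0 := by omega
    simp only [h1, h2, h3, if_false]
    split_ifs with h
    · rw [h3.2 h, h.2, add_zero]
    · rfl
  · simp only [σ, pathLaplacian, reindex_apply, submatrix_apply, of_apply,
      fromBlocks_apply₂₁, Equiv.symm_symm, Equiv.trans_apply, Equiv.sumCongr_apply, Sum.map_inl,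
      Sum.map_inr, Equiv.refl_apply, finSumFinEquiv_apply_right, Fin.val_natAdd,
      finSumFinEquiv_apply_left, Fin.revPerm_apply, Fin.val_castAdd, Fin.val_rev]
    have h1 : m + i ≠ m - (j + 1) := by omega
    have h2 : m + i + 1 ≠ m - (j + 1) := by omega
    have h3 : m - (j + 1) + 1 = m + i ↔ i = 0 ∧ j = 0 := by omega
    simp only [h1, h2, h3, if_false]
    split_ifs with h
    · rw [h3.2 h, h.1, add_zero]
    · rfl
  · simp only [σ, pathLaplacian, revJacobi, pathDiag, reindex_apply, submatrix_apply, of_apply,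
      fromBlocks_apply₂₂, Equiv.symm_symm, Equiv.trans_apply, Equiv.sumCongr_apply,
      Sum.map_inr, Equiv.refl_apply, finSumFinEquiv_apply_right, Fin.val_natAdd]
    have hr' : ∀ a b, a + b = m + m → 1 ≤ a → 1 ≤ b → r a = r b := by
      intro a b hab ha hb
      rw [← hsymm b hb (by omega)]
      congr 1
      omega
    split_ifs
    all_goals first
      | rfl
      | omega
      | exact congrArg Neg.neg (hr' _ _ (by omega) (by omega) (by omega))
      | rw [add_zero, zero_add, hr' (m + i) (m - 1 - i + 1) (by omega) (by omega) (by omega)]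
      | rw [hr' (m + i) (m - 1 - i + 1) (by omega) (by omega) (by omega),
          hr' (m + i + 1) (m - 1 - i) (by omega) (by omega) (by omega), add_comm]

theorem apply_sub_eq_of_persymmetric (n : ℕ) (r : ℕ → ℝ)
    (hpersym : ∀ j k : Fin n,
      pathLaplacian n r j k = pathLaplacian n r k.rev j.rev)
    (j : ℕ) (hj : 1 ≤ j) (hjn : j ≤ n - 1) : r (n - j) = r j := by
  have h := hpersym ⟨j - 1, by omega⟩ ⟨j, by omega⟩
  have h1 : j - 1 ≠ j := by omega
  have h2 : j - 1 + 1 = j := by omega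
  have h3 : n - (j + 1) ≠ n - j := by omega
  have h4 : n - (j + 1) + 1 = n - j := by omega
  simpa [pathLaplacian, Fin.val_rev, h1, h2, h3, h4, eq_comm] using h

/-- For `n ≥ 4` even, a persymmetric weighted path Laplacian with eigenvalues
`α 1 < ⋯ < α n` satisfies `r (n/2) = S₁/2` and `r (n/2 - 1) = (S₂ - S₁²)/(2 S₁)`, where
`S₁ = ∑ (-1)^(r+n) α r` and `S₂ = ∑ (-1)^(r+n) (α r)^2`. -/
theorem laplacian_middle_entries_even (n : ℕ) (hn : 4 ≤ n) (heven : Even n) (r : ℕ → ℝ)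
    (hr : ∀ j, 1 ≤ j → j ≤ n - 1 → 0 < r j)
    (hpersym : ∀ j k : Fin n,
      pathLaplacian n r j k = pathLaplacian n r k.rev j.rev)
    (α : ℕ → ℝ) (hα : StrictMonoOn α (Set.Icc 1 n))
    (hchar : (pathLaplacian n r).charpoly = ∏ i ∈ Finset.Icc 1 n, (X - C (α i)))
    (S₁ S₂ : ℝ)
    (hS₁ : S₁ = ∑ i ∈ Finset.Icc 1 n, (-1 : ℝ) ^ (i + n) * α i)
    (hS₂ : S₂ = ∑ i ∈ Finset.Icc 1 n, (-1 : ℝ) ^ (i + n) * (α i) ^ 2) :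
    r (n / 2) = S₁ / 2 ∧ r (n / 2 - 1) = (S₂ - S₁ ^ 2) / (2 * S₁) := by
  obtain ⟨m, rfl⟩ := heven
  obtain ⟨k, rfl⟩ : ∃ k, m = k + 2 := ⟨m - 2, by omega⟩
  set d := pathDiag r with hd
  set e : ℕ → ℝ := fun j => -r (j + 1) with he
  have hL := charpoly_pathLaplacian_eq (k + 2) (by omega) r
    (apply_sub_eq_of_persymmetric _ r hpersym)
  set A := revJacobi d e (k + 2) + Matrix.of fun i j : Fin (k + 2) =>
    if (i : ℕ) = 0 ∧ (j : ℕ) = 0 then -r (k + 2) else 0 with hA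
  set B := revJacobi d e (k + 2) - Matrix.of fun i j : Fin (k + 2) =>
    if (i : ℕ) = 0 ∧ (j : ℕ) = 0 then -r (k + 2) else 0 with hB
  have hpA := charpoly_revJacobi_add d e k (-r (k + 2)) A (by
    intro i j
    simp only [hA, Matrix.add_apply, of_apply, Fin.val_eq_zero_iff])
  have hpB := charpoly_revJacobi_add d e k (r (k + 2)) B (by
    intro i j
    simp only [hB, Matrix.sub_apply, of_apply, Fin.val_eq_zero_iff]
    split_ifs <;> ring)
  have hpu := charpoly_revJacobi_succ_succ d e k
  have hrm : 0 < r (k + 2) := hr _ (by omega) (by omega)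
  have hW : ∀ x, 0 < A.charpoly.eval x * (derivative B.charpoly).eval x
      - (derivative A.charpoly).eval x * B.charpoly.eval x := by
    intro x
    rcases wronskian_charpoly_revJacobi_pos d e (k + 1) x with h | ⟨j, hj, hj0⟩
    · have hA' : A.charpoly = (revJacobi d e (k + 2)).charpoly
          + C (r (k + 2)) * (revJacobi d e (k + 1)).charpoly := by
        rw [hpA, hpu, C_add, C_neg]
        ring
      have hB' : B.charpoly = (revJacobi d e (k + 2)).charpoly
          - C (r (k + 2)) * (revJacobi d e (k + 1)).charpoly := by
        rw [hpB, hpu, C_add]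
        ring
      rw [hA', hB']
      simp only [derivative_sub, derivative_add, derivative_C_mul, eval_sub, eval_mul,
        eval_add, eval_C]
      have := mul_pos hrm h
      linarith
    · have := hr (j + 1) (by omega) (by omega)
      simp only [he] at hj0
      linarith
  obtain ⟨hcE, hcO, hE, hO⟩ := eq_prod_of_wronskian_pos _ (k + 2) rfl α hα A.charpoly B.charpoly
    A.charpoly_monic B.charpoly_monic (by simp) (by simp) (hL.symm.trans hchar) hW
  rw [sum_neg_one_pow_mul_eq] at hS₁ hS₂
  set E := (Finset.Icc 1 (k + 2 + (k + 2))).filter fun i => Even (i + (k + 2 + (k + 2)))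
  set O := (Finset.Icc 1 (k + 2 + (k + 2))).filter fun i => ¬ Even (i + (k + 2 + (k + 2)))
  have hE1 := prod_X_sub_C_coeff_card_pred E α (by omega)
  have hO1 := prod_X_sub_C_coeff_card_pred O α (by omega)
  have hE2 := two_mul_prod_X_sub_C_coeff E α k hcE
  have hO2 := two_mul_prod_X_sub_C_coeff O α k hcO
  rw [← hE, hpB] at hE1 hE2
  rw [← hO, hpA] at hO1 hO2
  rw [hcE] at hE1
  rw [hcO] at hO1
  have hv1 : (revJacobi d e (k + 1)).charpoly.coeff (k + 1) = 1 := by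
    simpa using (revJacobi d e (k + 1)).charpoly_monic.coeff_natDegree
  have hw0 : (revJacobi d e k).charpoly.coeff k = 1 := by
    simpa using (revJacobi d e k).charpoly_monic.coeff_natDegree
  have hw1 : (revJacobi d e k).charpoly.coeff (k + 1) = 0 :=
    coeff_eq_zero_of_natDegree_lt (by simp)
  have hdk : d (k + 1) = r (k + 1) + r (k + 2) := by simp [hd, pathDiag]
  have hk1 : k + 2 - 1 = k + 1 := rfl
  rw [hk1, coeff_sub, coeff_X_sub_C_mul, coeff_C_mul, hv1, hw1, hdk] at hE1 hO1
  rw [coeff_sub, sub_mul, coeff_sub, coeff_C_mul, coeff_C_mul, hw0, hdk] at hE2 hO2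
  have hS₁' : S₁ = 2 * r (k + 2) := by linarith
  have hOs : ∑ i ∈ O, α i = r (k + 1) - (revJacobi d e (k + 1)).charpoly.coeff k := by linarith
  have hEs : ∑ i ∈ E, α i
      = r (k + 1) + 2 * r (k + 2) - (revJacobi d e (k + 1)).charpoly.coeff k := by linarith
  rw [hOs] at hO2
  rw [hEs] at hE2
  have hS₂' : S₂ = 4 * r (k + 2) * r (k + 1) + 4 * r (k + 2) ^ 2 := by
    rw [hS₂]
    linear_combination hE2 - hO2
  have h1 : (k + 2 + (k + 2)) / 2 = k + 2 := by omega
  rw [h1, hk1, hS₂', hS₁']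
  refine ⟨by ring, ?_⟩
  field_simp
  ring
end

section
/- Let n ≥ 3 be odd and let L be the Laplacian of a weighted path on n vertices with edge weights r_1, ..., r_{n-1} > 0, and assume L is persymmetric (equivalently, r_j = r_{n-j} for all j). Let α_1 < ... < α_n denote the eigenvalues of L, and set S_1 = Σ_{r=1}^n (-1)^{r+n} α_r and S_2 = Σ_{r=1}^n (-1)^{r+n} α_r². Then 2r_{(n-1)/2} = S_1, r_{(n-1)/2} = √(S_2 - S_1²)/2, and consequently S_2 = 2S_1². -/
open Matrix Polynomial

/-- An eigenvector of a tridiagonal matrix with nonzero superdiagonal is determined by its first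
entry. -/
lemma eq_zero_of_tridiagonal_of_apply_zero {n : ℕ} {A : Matrix (Fin (n + 1)) (Fin (n + 1)) ℝ}
    (htri : ∀ j k : Fin (n + 1), (j : ℕ) + 1 < k → A j k = 0)
    (hoff : ∀ i : Fin n, A i.castSucc i.succ ≠ 0) {μ : ℝ} {v : Fin (n + 1) → ℝ}
    (hv : A *ᵥ v = μ • v) (h0 : v 0 = 0) : v = 0 := by
  have key : ∀ m : ℕ, ∀ k : Fin (n + 1), (k : ℕ) ≤ m → v k = 0 := by
    intro m
    induction m with
    | zero =>
      intro k hk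
      rwa [show k = 0 from Fin.ext (by simpa using hk)]
    | succ m ih =>
      intro k hk
      rcases Nat.lt_or_ge (k : ℕ) (m + 1) with hlt | hge
      · exact ih k (by omega)
      · obtain ⟨i, rfl⟩ : ∃ i : Fin n, k = i.succ := Fin.exists_succ_eq.2 (by
          rintro rfl
          simp at hge) |>.imp fun _ h => h.symm
        have hi : (i : ℕ) = m := by
          simp only [Fin.val_succ] at hk hge
          omega
        have hrow := congrFun hv i.castSucc
        have hsum : (A *ᵥ v) i.castSucc = A i.castSucc i.succ * v i.succ := by
          rw [Matrix.mulVec, dotProduct]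
          refine Finset.sum_eq_single _ (fun b _ hb => ?_) (by simp)
          rcases Nat.lt_or_ge m b with h | h
          · have : (b : ℕ) ≠ m + 1 := fun h' => hb (Fin.ext (by simp [h', hi]))
            rw [htri _ _ (by simp only [Fin.val_castSucc]; omega), zero_mul]
          · rw [ih b h, mul_zero]
        rw [hsum, Pi.smul_apply, ih i.castSucc (by simp [hi]), smul_zero] at hrow
        exact (mul_eq_zero.1 hrow).resolve_left (hoff i)
  exact funext fun k => key k k le_rfl

/-- The corner entry of the adjugate of a tridiagonal matrix. -/
lemma adjugate_zero_last_of_tridiagonal {n : ℕ} {M : Matrix (Fin (n + 1)) (Fin (n + 1)) ℝ}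
    (htri : ∀ j k : Fin (n + 1), (j : ℕ) + 1 < k → M j k = 0) :
    M.adjugate 0 (Fin.last n) = (-1) ^ n * ∏ i : Fin n, M i.castSucc i.succ := by
  rw [adjugate_fin_succ_eq_det_submatrix, det_of_isLowerTriangular]
  · simp
  · intro i j hij
    have hij' : i < j := hij
    simp only [submatrix_apply, Fin.succAbove_last, Fin.zero_succAbove]
    exact htri _ _ (by simpa using hij')

/-- The derivative of a product of linear factors with increasing roots alternates in sign along
the roots. -/
lemma neg_one_pow_mul_prod_erase_pos {n : ℕ} {a : Fin (n + 1) → ℝ} (ha : StrictMono a)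
    (i : Fin (n + 1)) : 0 < (-1) ^ (n - i : ℕ) * ∏ j ∈ Finset.univ.erase i, (a i - a j) := by
  have hsplit : Finset.univ.erase i = Finset.Iio i ∪ Finset.Ioi i := by
    ext j
    simp [lt_or_lt_iff_ne]
  have hdisj : Disjoint (Finset.Iio i) (Finset.Ioi i) :=
    Finset.disjoint_left.2 fun j h1 h2 => by
      simp only [Finset.mem_Iio, Finset.mem_Ioi] at h1 h2
      exact lt_asymm h1 h2
  have hIoi : ∏ j ∈ Finset.Ioi i, (a i - a j) =
      (-1) ^ (n - i : ℕ) * ∏ j ∈ Finset.Ioi i, (a j - a i) := by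
    rw [show (n - i : ℕ) = (Finset.Ioi i).card by simp, ← Finset.prod_neg]
    simp
  have hsq : ((-1 : ℝ) ^ (n - i : ℕ)) * (-1) ^ (n - i : ℕ) = 1 := by
    rw [← mul_pow]
    simp
  have h1 : 0 < ∏ j ∈ Finset.Iio i, (a i - a j) :=
    Finset.prod_pos fun j hj => sub_pos.2 (ha (Finset.mem_Iio.1 hj))
  have h2 : 0 < ∏ j ∈ Finset.Ioi i, (a j - a i) :=
    Finset.prod_pos fun j hj => sub_pos.2 (ha (Finset.mem_Ioi.1 hj))
  rw [hsplit, Finset.prod_union hdisj, hIoi]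
  calc (0 : ℝ) < (∏ j ∈ Finset.Iio i, (a i - a j)) * ∏ j ∈ Finset.Ioi i, (a j - a i) :=
        mul_pos h1 h2
    _ = ((-1 : ℝ) ^ (n - i : ℕ) * (-1) ^ (n - i : ℕ)) *
          ((∏ j ∈ Finset.Iio i, (a i - a j)) * ∏ j ∈ Finset.Ioi i, (a j - a i)) := by
        rw [hsq, one_mul]
    _ = _ := by ring

/-- A real matrix whose characteristic polynomial has distinct roots `a i` is diagonalizable. -/
lemma exists_isUnit_mul_eq_mul_diagonal {n : ℕ} {A : Matrix (Fin n) (Fin n) ℝ} {a : Fin n → ℝ}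
    (ha : Function.Injective a) (hchar : A.charpoly = ∏ i, (X - C (a i))) :
    ∃ P : Matrix (Fin n) (Fin n) ℝ, IsUnit P ∧ A * P = P * diagonal a := by
  have hex : ∀ i, ∃ v : Fin n → ℝ, v ≠ 0 ∧ A *ᵥ v = a i • v := by
    intro i
    have hdet : (scalar (Fin n) (a i) - A).det = 0 := by
      rw [← eval_charpoly, hchar, eval_prod]
      exact Finset.prod_eq_zero (Finset.mem_univ i) (by simp)
    obtain ⟨v, hv, h⟩ := exists_mulVec_eq_zero_iff.2 hdet
    refine ⟨v, hv, ?_⟩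
    rw [sub_mulVec, sub_eq_zero] at h
    rw [← h]
    ext j
    simp [mulVec_diagonal]
  choose v hv hAv using hex
  refine ⟨(Matrix.of v)ᵀ, ?_, ?_⟩
  · rw [← linearIndependent_cols_iff_isUnit]
    refine Module.End.eigenvectors_linearIndependent' (toLin' A) a ha _ fun i => ⟨?_, hv i⟩
    rw [Module.End.mem_eigenspace_iff, toLin'_apply]
    exact hAv i
  · ext j i
    rw [mul_diagonal, mul_comm]
    exact congrFun (hAv i) j

/-- The trace of the adjugate of `μ - A` for diagonalizable `A`. -/
lemma trace_adjugate_of_mul_eq_mul_diagonal {n : ℕ} {M P : Matrix (Fin n) (Fin n) ℝ}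
    {d : Fin n → ℝ} (hP : IsUnit P) (hMP : M * P = P * diagonal d) :
    M.adjugate.trace = ∑ i, ∏ j ∈ Finset.univ.erase i, d j := by
  have hdet : IsUnit P.det := (isUnit_iff_isUnit_det P).1 hP
  have hM : M = P * diagonal d * P⁻¹ := by
    rw [← hMP, mul_nonsing_inv_cancel_right _ _ hdet]
  rw [hM, adjugate_mul_distrib, adjugate_mul_distrib, ← Matrix.mul_assoc, trace_mul_comm,
    ← Matrix.mul_assoc, ← adjugate_mul_distrib, nonsing_inv_mul _ hdet, adjugate_one,
    Matrix.one_mul, adjugate_diagonal, trace_diagonal]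

/-- The eigenvectors of a persymmetric Jacobi matrix with negative off-diagonal are alternately
symmetric and antisymmetric, starting with the smallest eigenvalue. -/
lemma eigenvector_rev_of_persymmetric {n : ℕ} {A P : Matrix (Fin (n + 1)) (Fin (n + 1)) ℝ}
    (hsymm : A.IsSymm) (hrev : ∀ j k, A j.rev k.rev = A j k)
    (htri : ∀ j k : Fin (n + 1), (j : ℕ) + 1 < k → A j k = 0)
    (hneg : ∀ i : Fin n, A i.castSucc i.succ < 0)
    {a : Fin (n + 1) → ℝ} (ha : StrictMono a) (hP : IsUnit P) (hAP : A * P = P * diagonal a)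
    (i j : Fin (n + 1)) : P j.rev i = (-1) ^ (i : ℕ) * P j i := by
  have hvec : ∀ i, A *ᵥ P.col i = a i • P.col i := by
    intro i
    ext j
    have := congrFun (congrFun hAP j) i
    rw [mul_diagonal, mul_comm] at this
    exact this
  have huniq : ∀ w : Fin (n + 1) → ℝ, A *ᵥ w = a i • w → w 0 = 0 → w = 0 := fun w hw h0 =>
    eq_zero_of_tridiagonal_of_apply_zero htri (fun i => (hneg i).ne) hw h0
  set v : Fin (n + 1) → ℝ := P.col i with hv
  have hAv : A *ᵥ v = a i • v := hvec i
  have hv0 : v 0 ≠ 0 := by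
    intro h0
    have hne : v ≠ 0 := (linearIndependent_cols_iff_isUnit.2 hP).ne_zero i
    exact hne (huniq v hAv h0)
  have hprop : ∀ w : Fin (n + 1) → ℝ, A *ᵥ w = a i • w → ∀ j, v 0 * w j = w 0 * v j := by
    intro w hw j
    have := huniq (v 0 • w - w 0 • v) (by
      rw [mulVec_sub, mulVec_smul, mulVec_smul, hw, hAv, smul_sub, smul_comm (v 0),
        smul_comm (w 0)]) (by simp [mul_comm])
    have h := congrFun this j
    simpa [sub_eq_zero] using h
  have hArev : A *ᵥ (fun j => v j.rev) = a i • fun j => v j.rev := by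
    ext j
    have h := congrFun hAv j.rev
    simp only [mulVec, dotProduct, Pi.smul_apply] at h ⊢
    rw [← h, ← Equiv.sum_comp Fin.revPerm]
    refine Finset.sum_congr rfl fun k _ => ?_
    simp [← hrev j]
  -- the reversal multiplies the eigenvector by `ε = v (last) / v 0`
  have hlast : ∀ j, v 0 * v j.rev = v (Fin.last n) * v j := by
    intro j
    simpa using hprop _ hArev j
  have hsq : v (Fin.last n) * v (Fin.last n) = v 0 * v 0 := by
    simpa using (hlast (Fin.last n)).symm
  set M := scalar (Fin (n + 1)) (a i) - A with hM
  have hMP : M * P = P * diagonal fun j => a i - a j := by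
    rw [hM, Matrix.sub_mul, hAP]
    ext j k
    simp [Matrix.mul_diagonal, scalar_apply, Matrix.diagonal_mul]
    ring
  have hMdet : M.det = 0 := by
    have : M *ᵥ v = 0 := by
      rw [hM, sub_mulVec, hAv, sub_eq_zero]
      ext j
      simp [mulVec_diagonal]
    exact exists_mulVec_eq_zero_iff.1 ⟨v, fun h => hv0 (by simp [h]), this⟩
  have hMsymm : M.adjugateᵀ = M.adjugate := by
    rw [adjugate_transpose, hM, transpose_sub, hsymm.eq]
    simp
  have hadj : ∀ k, A *ᵥ M.adjugate.col k = a i • M.adjugate.col k := by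
    intro k
    ext j
    have h := congrFun (congrFun (mul_adjugate M) j) k
    rw [hMdet, zero_smul] at h
    nth_rewrite 1 [hM] at h
    rw [Matrix.sub_mul, Matrix.sub_apply] at h
    simp only [scalar_apply, diagonal_mul, Matrix.zero_apply] at h
    exact (sub_eq_zero.1 h).symm
  have hrank : ∀ j k, v 0 * v 0 * M.adjugate j k = M.adjugate 0 0 * (v j * v k) := by
    intro j k
    have h1 : v 0 * M.adjugate j k = M.adjugate 0 k * v j := hprop _ (hadj k) j
    have h2 : v 0 * M.adjugate k 0 = M.adjugate 0 0 * v k := hprop _ (hadj 0) k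
    have h3 : M.adjugate k 0 = M.adjugate 0 k := congrFun (congrFun hMsymm 0) k
    rw [mul_assoc, h1, ← h3, ← mul_assoc, h2]
    ring
  have htrace : v 0 * v 0 * ∏ j ∈ Finset.univ.erase i, (a i - a j) =
      M.adjugate 0 0 * ∑ j, v j * v j := by
    have h : M.adjugate.trace = ∏ j ∈ Finset.univ.erase i, (a i - a j) := by
      rw [trace_adjugate_of_mul_eq_mul_diagonal hP hMP]
      refine Finset.sum_eq_single i (fun b _ hb => ?_) (by simp)
      exact Finset.prod_eq_zero (Finset.mem_erase.2 ⟨hb.symm, Finset.mem_univ i⟩) (sub_self _)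
    rw [← h, Matrix.trace, Finset.mul_sum, Finset.mul_sum]
    exact Finset.sum_congr rfl fun j _ => hrank j j
  have hcorner : 0 < (-1) ^ n * M.adjugate 0 (Fin.last n) := by
    have hoff : ∀ j k : Fin (n + 1), j ≠ k → M j k = -A j k := fun j k hjk => by
      simp [hM, scalar_apply, diagonal_apply_ne _ hjk]
    rw [adjugate_zero_last_of_tridiagonal, ← mul_assoc, ← mul_pow]
    · simp only [mul_neg, mul_one, neg_neg, one_pow, one_mul]
      refine Finset.prod_pos fun k _ => ?_
      rw [hoff _ _ (Fin.castSucc_lt_succ).ne]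
      exact neg_pos.2 (hneg k)
    · intro j k hjk
      rw [hoff _ _ (fun h => by subst h; omega), htri _ _ hjk, neg_zero]
  have hprod := neg_one_pow_mul_prod_erase_pos ha i
  have hv2 : 0 < v 0 * v 0 := mul_self_pos.2 hv0
  have hsum : 0 < ∑ j, v j * v j :=
    Finset.sum_pos' (fun j _ => mul_self_nonneg _) ⟨0, Finset.mem_univ _, hv2⟩
  have hpow : (-1 : ℝ) ^ n = (-1) ^ (n - i : ℕ) * (-1) ^ (i : ℕ) := by
    rw [← pow_add, Nat.sub_add_cancel (Nat.lt_succ_iff.1 i.2)]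
  have hsgn : 0 < (-1) ^ (n - i : ℕ) * M.adjugate 0 0 := by
    have : 0 < ((-1) ^ (n - i : ℕ) * M.adjugate 0 0) * ∑ j, v j * v j := by
      rw [mul_assoc, ← htrace]
      calc 0 < v 0 * v 0 * ((-1) ^ (n - i : ℕ) * ∏ j ∈ Finset.univ.erase i, (a i - a j)) :=
            mul_pos hv2 hprod
        _ = _ := by ring
    exact pos_of_mul_pos_left this hsum.le
  have hε : 0 < (-1) ^ (i : ℕ) * (v 0 * v (Fin.last n)) := by
    have h : 0 < ((-1) ^ (n - i : ℕ) * M.adjugate 0 0) *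
        ((-1) ^ (i : ℕ) * (v 0 * v (Fin.last n))) := by
      calc 0 < v 0 * v 0 * ((-1) ^ n * M.adjugate 0 (Fin.last n)) := mul_pos hv2 hcorner
        _ = (-1) ^ n * (v 0 * v 0 * M.adjugate 0 (Fin.last n)) := by ring
        _ = _ := by rw [hrank, hpow]; ring
    exact pos_of_mul_pos_right h hsgn.le
  have hfinal : v (Fin.last n) = (-1) ^ (i : ℕ) * v 0 := by
    rcases mul_self_eq_mul_self_iff.1 hsq with h | h <;>
      rcases neg_one_pow_eq_or ℝ (i : ℕ) with h' | h' <;> rw [h, h'] at hε <;> rw [h, h'] <;>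
      first
      | (exfalso; nlinarith only [hε, hv2])
      | ring
  have h := hlast j
  rw [hfinal] at h
  refine mul_left_cancel₀ hv0 ?_
  change v 0 * v j.rev = v 0 * ((-1) ^ (i : ℕ) * v j)
  rw [h]
  ring

/-- A matrix `B` diagonalized by a basis of alternately symmetric and antisymmetric vectors has
alternating eigenvalue sum equal to the sum of its antidiagonal. -/
lemma sum_apply_rev_eq_alternating_sum {n : ℕ} {B P : Matrix (Fin n) (Fin n) ℝ} {b : Fin n → ℝ}
    (hP : IsUnit P) (hBP : B * P = P * diagonal b)
    (hrev : ∀ i j : Fin n, P j.rev i = (-1) ^ (i : ℕ) * P j i) :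
    ∑ j, B j.rev j = ∑ i : Fin n, (-1) ^ (i : ℕ) * b i := by
  have hdet : IsUnit P.det := (isUnit_iff_isUnit_det P).1 hP
  have hR : B.submatrix Fin.rev id * P = P * diagonal fun i : Fin n => (-1) ^ (i : ℕ) * b i := by
    ext j i
    have h := congrFun (congrFun hBP j.rev) i
    rw [mul_diagonal, hrev] at h
    rw [mul_diagonal]
    refine Eq.trans (Eq.trans ?_ h) (by ring)
    rfl
  have hB : B.submatrix Fin.rev id = P * (diagonal fun i : Fin n => (-1) ^ (i : ℕ) * b i) * P⁻¹ := by
    rw [← hR, mul_nonsing_inv_cancel_right _ _ hdet]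
  calc ∑ j, B j.rev j = (B.submatrix Fin.rev id).trace := rfl
    _ = ∑ i : Fin n, (-1) ^ (i : ℕ) * b i := by
      rw [hB, trace_mul_comm, ← Matrix.mul_assoc, nonsing_inv_mul _ hdet, Matrix.one_mul,
        trace_diagonal]

lemma pathLaplacian_isSymm (n : ℕ) (r : ℕ → ℝ) : (pathLaplacian n r).IsSymm := by
  ext j k
  simp only [transpose_apply, pathLaplacian, of_apply]
  split_ifs <;> first | rfl | omega | simp_all

lemma pathLaplacian_apply_of_add_one_lt {n : ℕ} (r : ℕ → ℝ) {j k : Fin n}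
    (h : (j : ℕ) + 1 < k) : pathLaplacian n r j k = 0 := by
  simp only [pathLaplacian, of_apply]
  rw [if_neg (by omega), if_neg (by omega), if_neg (by omega)]

lemma pathLaplacian_apply_of_add_one_eq {n : ℕ} (r : ℕ → ℝ) {j k : Fin n}
    (h : (j : ℕ) + 1 = k) : pathLaplacian n r j k = -r k := by
  simp only [pathLaplacian, of_apply]
  rw [if_neg (by omega), if_pos h, h]

lemma pathLaplacian_apply_self {n : ℕ} (r : ℕ → ℝ) {j : Fin n} (h0 : (j : ℕ) ≠ 0)
    (hn : (j : ℕ) ≠ n - 1) : pathLaplacian n r j j = r j + r (j + 1) := by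
  simp [pathLaplacian, h0, hn]

/-- A sum supported on three given indices. -/
lemma sum_eq_add_add_of_ne {ι : Type*} [Fintype ι] [DecidableEq ι] {x y z : ι}
    (hxy : x ≠ y) (hxz : x ≠ z) (hyz : y ≠ z) (f : ι → ℝ)
    (hf : ∀ i, i ≠ x → i ≠ y → i ≠ z → f i = 0) : ∑ i, f i = f x + f y + f z := by
  rw [← Finset.sum_subset (Finset.subset_univ {x, y, z}) fun i _ hi => ?_,
    Finset.sum_insert (by simp [hxy, hxz]), Finset.sum_pair hyz, add_assoc]
  simp only [Finset.mem_insert, Finset.mem_singleton, not_or] at hi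
  exact hf i hi.1 hi.2.1 hi.2.2

/-- The antidiagonal sums of a persymmetric path Laplacian of odd size and of its square. -/
lemma sum_pathLaplacian_apply_rev {p : ℕ} {r : ℕ → ℝ} (hr : r (p + 1) = r (p + 2)) :
    ∑ j, pathLaplacian (2 * (p + 1) + 1) r j.rev j = 2 * r (p + 1) ∧
      ∑ j, (pathLaplacian (2 * (p + 1) + 1) r * pathLaplacian (2 * (p + 1) + 1) r) j.rev j =
        8 * r (p + 1) ^ 2 := by
  set L := pathLaplacian (2 * (p + 1) + 1) r with hL
  have hsymm : ∀ j k, L j k = L k j := fun j k => (pathLaplacian_isSymm _ r).apply k j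
  have hfar : ∀ j k : Fin (2 * (p + 1) + 1), (j : ℕ) + 1 < k ∨ (k : ℕ) + 1 < j → L j k = 0 := by
    rintro j k (h | h)
    · exact pathLaplacian_apply_of_add_one_lt r h
    · rw [hsymm]
      exact pathLaplacian_apply_of_add_one_lt r h
  let x : Fin (2 * (p + 1) + 1) := ⟨p, by omega⟩
  let y : Fin (2 * (p + 1) + 1) := ⟨p + 1, by omega⟩
  let z : Fin (2 * (p + 1) + 1) := ⟨p + 2, by omega⟩
  have hxr : x.rev = z := Fin.ext (by simp only [x, z, Fin.val_rev]; omega)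
  have hyr : y.rev = y := Fin.ext (by simp only [y, Fin.val_rev]; omega)
  have hzr : z.rev = x := Fin.ext (by simp only [x, z, Fin.val_rev]; omega)
  have hxy : x ≠ y := Fin.ne_of_val_ne (by simp only [x, y]; omega)
  have hxz : x ≠ z := Fin.ne_of_val_ne (by simp only [x, z]; omega)
  have hyz : y ≠ z := Fin.ne_of_val_ne (by simp only [y, z]; omega)
  have hLxy : L x y = -r (p + 1) := pathLaplacian_apply_of_add_one_eq r rfl
  have hLyz : L y z = -r (p + 1) := hr ▸ pathLaplacian_apply_of_add_one_eq r rfl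
  have hLyy : L y y = 2 * r (p + 1) := by
    rw [hL, pathLaplacian_apply_self r (by simp [y]) (by simp only [y]; omega)]
    simp only [y]
    rw [← hr]
    ring
  have hLxz : L x z = 0 := hfar x z (Or.inl (by simp only [x, z]; omega))
  have hval : ∀ k : Fin (2 * (p + 1) + 1), k ≠ x → k ≠ y → k ≠ z →
      (k : ℕ) ≠ p ∧ (k : ℕ) ≠ p + 1 ∧ (k : ℕ) ≠ p + 2 := fun k h1 h2 h3 =>
    ⟨fun h => h1 (Fin.ext h), fun h => h2 (Fin.ext h), fun h => h3 (Fin.ext h)⟩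
  have hzero : ∀ j k : Fin (2 * (p + 1) + 1),
      (j : ℕ) + 2 ≤ p + 1 ∨ p + 3 ≤ j ∨ (k : ℕ) + 2 ≤ p + 1 ∨ p + 3 ≤ k →
        L j.rev k * L k j = 0 := by
    intro j k h
    have hj := j.2
    have hjr : (j.rev : ℕ) = 2 * (p + 1) - j := by rw [Fin.val_rev]; omega
    by_cases h1 : (k : ℕ) + 1 < j ∨ (j : ℕ) + 1 < k
    · rw [hfar k j h1, mul_zero]
    · rw [hfar j.rev k (by omega), zero_mul]
  constructor
  · rw [Finset.sum_eq_single y _ (by simp), hyr, hLyy]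
    intro j _ hj
    have hj' : (j : ℕ) ≠ p + 1 := fun h => hj (Fin.ext h)
    have := j.2
    exact hfar _ _ (by rw [Fin.val_rev]; omega)
  · simp only [Matrix.mul_apply]
    have hinner : ∀ j, ∑ k, L j.rev k * L k j =
        L j.rev x * L x j + L j.rev y * L y j + L j.rev z * L z j := fun j =>
      sum_eq_add_add_of_ne hxy hxz hyz _ fun k h1 h2 h3 => hzero j k (by
        have := hval k h1 h2 h3
        omega)
    rw [sum_eq_add_add_of_ne hxy hxz hyz _ fun j h1 h2 h3 => ?_]
    · rw [hinner, hinner, hinner, hxr, hyr, hzr, hsymm z x, hsymm z y, hsymm y x, hLxy, hLyz,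
        hLyy, hLxz]
      ring
    · exact Finset.sum_eq_zero fun k _ => hzero j k (by
        have := hval j h1 h2 h3
        omega)

/-- Reindexing a product over `1, …, n` by `Fin n`. -/
@[to_additive]
lemma prod_Icc_eq_prod_fin {M : Type*} [CommMonoid M] (n : ℕ) (f : ℕ → M) :
    ∏ i ∈ Finset.Icc 1 n, f i = ∏ i : Fin n, f (i + 1) := by
  rw [show Finset.Icc 1 n = Finset.Ico 1 (n + 1) by grind,
    Finset.prod_Ico_eq_prod_range, Fin.prod_univ_eq_prod_range fun i => f (i + 1)]
  simp [add_comm]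

/-- For `n ≥ 3` odd, a persymmetric weighted path Laplacian with eigenvalues
`α 1 < ⋯ < α n` satisfies `2 r ((n-1)/2) = S₁`, `r ((n-1)/2) = √(S₂ - S₁²)/2`, and
consequently `S₂ = 2 S₁²`, where `S₁ = ∑ (-1)^(r+n) α r` and
`S₂ = ∑ (-1)^(r+n) (α r)^2`. -/
theorem laplacian_middle_entries_odd (n : ℕ) (hn : 3 ≤ n) (hodd : Odd n) (r : ℕ → ℝ)
    (hr : ∀ j, 1 ≤ j → j ≤ n - 1 → 0 < r j)
    (hpersym : ∀ j k : Fin n,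
      pathLaplacian n r j k = pathLaplacian n r k.rev j.rev)
    (α : ℕ → ℝ) (hα : StrictMonoOn α (Set.Icc 1 n))
    (hchar : (pathLaplacian n r).charpoly = ∏ i ∈ Finset.Icc 1 n, (X - C (α i)))
    (S₁ S₂ : ℝ)
    (hS₁ : S₁ = ∑ i ∈ Finset.Icc 1 n, (-1 : ℝ) ^ (i + n) * α i)
    (hS₂ : S₂ = ∑ i ∈ Finset.Icc 1 n, (-1 : ℝ) ^ (i + n) * (α i) ^ 2) :
    2 * r ((n - 1) / 2) = S₁ ∧ r ((n - 1) / 2) = Real.sqrt (S₂ - S₁ ^ 2) / 2 ∧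
      S₂ = 2 * S₁ ^ 2 := by
  obtain ⟨m, rfl⟩ := hodd
  obtain ⟨p, rfl⟩ : ∃ p, m = p + 1 := ⟨m - 1, by omega⟩
  have hmid : (2 * (p + 1) + 1 - 1) / 2 = p + 1 := by omega
  rw [hmid]
  have hrpos : 0 < r (p + 1) := hr _ (by omega) (by omega)
  set L := pathLaplacian (2 * (p + 1) + 1) r with hL
  have hsymm : L.IsSymm := pathLaplacian_isSymm _ r
  have hrev : ∀ j k, L j.rev k.rev = L j k := fun j k => by
    rw [hpersym j k, hsymm.apply]
  have hreq : r (p + 1) = r (p + 2) := by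
    have h := hrev ⟨p, by omega⟩ ⟨p + 1, by omega⟩
    rw [← hsymm.apply, hL, pathLaplacian_apply_of_add_one_eq r (by simp only [Fin.val_rev]; omega),
      pathLaplacian_apply_of_add_one_eq r rfl, neg_inj] at h
    simp only [Fin.val_rev] at h
    rw [← h]
    congr 1
    omega
  have hneg : ∀ i : Fin (2 * (p + 1)), L i.castSucc i.succ < 0 := fun i => by
    rw [hL, pathLaplacian_apply_of_add_one_eq r (by simp), neg_lt_zero]
    exact hr _ (by simp) (by simp only [Fin.val_succ]; omega)
  let a : Fin (2 * (p + 1) + 1) → ℝ := fun i => α (i + 1)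
  have ha : StrictMono a := fun i j hij =>
    hα (Set.mem_Icc.2 ⟨by omega, by omega⟩) (Set.mem_Icc.2 ⟨by omega, by omega⟩)
      (Nat.succ_lt_succ hij)
  have hsgn : ∀ i : ℕ, (-1 : ℝ) ^ (i + 1 + (2 * (p + 1) + 1)) = (-1) ^ i := fun i => by
    rw [show i + 1 + (2 * (p + 1) + 1) = i + 2 * (p + 2) by ring, pow_add, pow_mul]
    simp
  rw [prod_Icc_eq_prod_fin] at hchar
  rw [sum_Icc_eq_sum_fin] at hS₁ hS₂
  simp only [hsgn] at hS₁ hS₂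
  obtain ⟨P, hP, hLP⟩ := exists_isUnit_mul_eq_mul_diagonal (a := a) ha.injective hchar
  have hPrev := eigenvector_rev_of_persymmetric hsymm hrev
    (fun j k => pathLaplacian_apply_of_add_one_lt r) hneg ha hP hLP
  have hLLP : L * L * P = P * diagonal fun i => a i ^ 2 := by
    rw [Matrix.mul_assoc, hLP, ← Matrix.mul_assoc, hLP, Matrix.mul_assoc, diagonal_mul_diagonal]
    simp only [sq]
  obtain ⟨h1, h2⟩ := sum_pathLaplacian_apply_rev hreq
  have hS₁' : 2 * r (p + 1) = S₁ := by
    rw [hS₁, ← h1]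
    exact sum_apply_rev_eq_alternating_sum hP hLP hPrev
  have hS₂' : 8 * r (p + 1) ^ 2 = S₂ := by
    rw [hS₂, ← h2]
    exact sum_apply_rev_eq_alternating_sum hP hLLP hPrev
  refine ⟨hS₁', ?_, ?_⟩
  · rw [← hS₁', ← hS₂', show 8 * r (p + 1) ^ 2 - (2 * r (p + 1)) ^ 2 = (2 * r (p + 1)) ^ 2 by ring,
      Real.sqrt_sq (by positivity)]
    ring
  · rw [← hS₁', ← hS₂']
    ring
end
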